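/- arXiv:0811.0754 — 4 statements merged into one kernel-verified Lean document; each statement's English description precedes it below -/
import Mathlib

section
/- Let F be a homogeneous polynomial of degree d in the variables x₀,…,xₙ over ℂ, and let p ≤ q ≤ d with p ≥ 1. Suppose the polar map of degree p is regular, i.e., for every nonzero ξ ∈ ℂ^{n+1} with F(ξ) = 0 there exists an iterated partial derivative of F of order exactly p that does not vanish at ξ. Then the polar map of degree q is also regular: for every nonzero ξ ∈ ℂ^{n+1} with F(ξ) = 0 there exists an iterated partial derivative of F of order exactly q that does not vanish at ξ. -/
open MvPolynomial

/-- Iterated formal partial derivative along a tuple of indices. -/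
noncomputable def iterPderiv {n : ℕ} {s : ℕ} (t : Fin s → Fin (n + 1))
    (F : MvPolynomial (Fin (n + 1)) ℂ) : MvPolynomial (Fin (n + 1)) ℂ :=
  (List.ofFn t).foldl (fun P i => MvPolynomial.pderiv i P) F

lemma iterPderiv_snoc {n s : ℕ} (t : Fin s → Fin (n + 1)) (i : Fin (n + 1))
    (F : MvPolynomial (Fin (n + 1)) ℂ) :
    iterPderiv (Fin.snoc t i : Fin (s + 1) → Fin (n + 1)) F = pderiv i (iterPderiv t F) := by
  rw [iterPderiv, List.ofFn_succ_last]
  simp [iterPderiv]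

lemma iterPderiv_isHomogeneous {n d s : ℕ} (t : Fin s → Fin (n + 1))
    {F : MvPolynomial (Fin (n + 1)) ℂ} (hF : F.IsHomogeneous d) :
    (iterPderiv t F).IsHomogeneous (d - s) := by
  induction s with
  | zero => simpa [iterPderiv] using hF
  | succ s ih =>
    rw [← Fin.snoc_init_self t, iterPderiv_snoc, ← Nat.sub_sub]
    exact (ih _).pderiv

/-- By Euler's identity, a homogeneous polynomial of positive degree that does not vanish at a
point has a first partial derivative that does not vanish there. -/
lemma exists_eval_pderiv_ne_zero {σ R : Type*} [Fintype σ] [CommRing R] [IsDomain R] [CharZero R]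
    {m : ℕ} {G : MvPolynomial σ R} (hG : G.IsHomogeneous m) (hm : m ≠ 0) {ξ : σ → R}
    (h : eval ξ G ≠ 0) : ∃ i, eval ξ (pderiv i G) ≠ 0 := by
  by_contra! hzero
  have euler := congrArg (eval ξ) hG.sum_X_mul_pderiv
  simp [hzero, hm, h] at euler

/-- If a hypersurface of degree `d` has a regular polar map of degree `p`, then it
has a regular polar map of degree `q` for every `p ≤ q ≤ d`. -/
theorem regular_polar_map_of_higher_degree {n d p q : ℕ}
    (F : MvPolynomial (Fin (n + 1)) ℂ) (hF : F.IsHomogeneous d)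
    (hp : 1 ≤ p) (hpq : p ≤ q) (hqd : q ≤ d)
    (hreg : ∀ ξ : Fin (n + 1) → ℂ, ξ ≠ 0 → MvPolynomial.eval ξ F = 0 →
      ∃ t : Fin p → Fin (n + 1), MvPolynomial.eval ξ (iterPderiv t F) ≠ 0) :
    ∀ ξ : Fin (n + 1) → ℂ, ξ ≠ 0 → MvPolynomial.eval ξ F = 0 →
      ∃ t : Fin q → Fin (n + 1), MvPolynomial.eval ξ (iterPderiv t F) ≠ 0 := by
  intro ξ hξ hFξ
  induction q, hpq using Nat.le_induction with
  | base => exact hreg ξ hξ hFξ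
  | succ q hpq ih =>
    obtain ⟨t, ht⟩ := ih (by omega)
    obtain ⟨i, hi⟩ := exists_eval_pderiv_ne_zero (iterPderiv_isHomogeneous t hF) (by omega) ht
    exact ⟨Fin.snoc t i, by rwa [iterPderiv_snoc]⟩
end

section
/- Let F be a homogeneous polynomial of degree d in the variables x₀,…,xₙ over ℂ and let 1 ≤ p ≤ d. Suppose that for every nonzero ξ ∈ ℂ^{n+1} with F(ξ) = 0 there is an iterated partial derivative of F of order exactly p not vanishing at ξ (the degree-p polar map of V(F) is regular). Then in fact for EVERY nonzero ξ ∈ ℂ^{n+1} (with no condition that F(ξ) = 0), there exists an iterated partial derivative of F of order exactly p that does not vanish at ξ; consequently the degree-p polar map extends to a regular map defined on all of ℙⁿ. -/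
open MvPolynomial

theorem iterPderiv_cons {n s : ℕ} (i : Fin (n + 1)) (t : Fin s → Fin (n + 1))
    (F : MvPolynomial (Fin (n + 1)) ℂ) :
    iterPderiv (Fin.cons i t : Fin (s + 1) → Fin (n + 1)) F = iterPderiv t (pderiv i F) := by
  simp [iterPderiv, List.ofFn_succ]

/-- By Euler's identity, a form of degree `d` vanishes wherever all its iterated partial
derivatives of some order `p ≤ d` vanish. -/
theorem eval_eq_zero_of_iterPderiv_eval_eq_zero {n p d : ℕ} {F : MvPolynomial (Fin (n + 1)) ℂ}
    (hF : F.IsHomogeneous d) (hpd : p ≤ d) {ξ : Fin (n + 1) → ℂ}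
    (h : ∀ t : Fin p → Fin (n + 1), eval ξ (iterPderiv t F) = 0) : eval ξ F = 0 := by
  induction p generalizing F d with
  | zero => simpa [iterPderiv] using h Fin.elim0
  | succ p ih =>
    have hd : ∀ i, eval ξ (pderiv i F) = 0 := fun i =>
      ih hF.pderiv (by omega) fun t => by rw [← iterPderiv_cons]; exact h _
    have euler := congrArg (eval ξ) hF.sum_X_mul_pderiv
    simp only [map_sum, map_mul, hd, mul_zero, Finset.sum_const_zero, map_nsmul] at euler
    exact (smul_eq_zero.mp euler.symm).resolve_left (by omega)

/-- If the degree-`p` polar map of `V(F)` is regular (some order-`p` iterated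
partial derivative of `F` is nonzero at every nonzero zero of `F`), then at
EVERY nonzero point of `ℂ^{n+1}` some order-`p` iterated partial derivative of
`F` is nonzero; hence the polar map extends to a regular map on all of `ℙⁿ`. -/
theorem regular_polar_map_extends_to_projective_space {n d p : ℕ}
    (F : MvPolynomial (Fin (n + 1)) ℂ) (hF : F.IsHomogeneous d)
    (hp1 : 1 ≤ p) (hpd : p ≤ d)
    (hreg : ∀ ξ : Fin (n + 1) → ℂ, ξ ≠ 0 → MvPolynomial.eval ξ F = 0 →
      ∃ t : Fin p → Fin (n + 1), MvPolynomial.eval ξ (iterPderiv t F) ≠ 0) :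
    ∀ ξ : Fin (n + 1) → ℂ, ξ ≠ 0 →
      ∃ t : Fin p → Fin (n + 1), MvPolynomial.eval ξ (iterPderiv t F) ≠ 0 := by
  intro ξ hξ
  by_contra! h
  obtain ⟨t, ht⟩ := hreg ξ hξ (eval_eq_zero_of_iterPderiv_eval_eq_zero hF hpd h)
  exact ht (h t)
end

section
/- Let F be a homogeneous polynomial of degree d ≥ 2 in the three variables x₀, x₁, x₂ over ℂ, let p ∈ ℂ³ be a smooth point of the curve C = V(F), i.e., F(p) = 0 and the gradient ∇F(p) = ((∂₀F)(p), (∂₁F)(p), (∂₂F)(p)) is nonzero, and let v ∈ ℂ³ be a tangent vector at p: v is not a scalar multiple of p (and p, v are linearly independent) and ∇F(p)·v = 0. Let H_p be the 3×3 Hessian matrix (H_p)_{ij} = (∂_i∂_j F)(p). Then det H_p = 0 if and only if vᵀ H_p v = 0; that is, p is a flex of C (the tangent line at p meets C with contact order greater than 2) exactly when the Hessian determinant of F vanishes at p. -/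
open MvPolynomial
open scoped Matrix

/-- A matrix with rows `p`, `v`, `w`, where `p` and `v` are independent and killed by the
functional `g` while `w` is not, has nonzero determinant. -/
theorem det_ne_zero_of_dotProduct_ne_zero {K : Type*} [Field K] {p v w g : Fin 3 → K}
    (hind : LinearIndependent K ![p, v]) (hgp : g ⬝ᵥ p = 0) (hgv : g ⬝ᵥ v = 0)
    (hgw : g ⬝ᵥ w ≠ 0) : (Matrix.of ![p, v, w]).det ≠ 0 := by
  intro hdet
  obtain ⟨x, hx, hxP⟩ := Matrix.exists_vecMul_eq_zero_iff.mpr hdet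
  have hcomb : x 0 • p + x 1 • v + x 2 • w = 0 := by
    rw [← hxP]
    ext i
    simp [Matrix.vecMul, dotProduct, Fin.sum_univ_three]
  have hx2 : x 2 = 0 := by
    have h := congrArg (g ⬝ᵥ ·) hcomb
    simpa [dotProduct_add, hgp, hgv, hgw] using h
  obtain ⟨hx0, hx1⟩ := LinearIndependent.pair_iff.mp hind (x 0) (x 1) (by simpa [hx2] using hcomb)
  exact hx (by ext i; fin_cases i <;> assumption)

/-- If a symmetric `3 × 3` matrix `H` sends `p` to a nonzero multiple of `g ≠ 0` and `p`, `v` are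
independent vectors orthogonal to `g`, then `H` is singular iff `v` is isotropic for `H`. -/
theorem det_eq_zero_iff_isotropic_of_mulVec_eq_smul {K : Type*} [Field K]
    {H : Matrix (Fin 3) (Fin 3) K} (hH : H.IsSymm) {p v g : Fin 3 → K} {c : K} (hc : c ≠ 0)
    (hHp : H *ᵥ p = c • g) (hg : g ≠ 0) (hind : LinearIndependent K ![p, v])
    (hgp : g ⬝ᵥ p = 0) (hgv : g ⬝ᵥ v = 0) : H.det = 0 ↔ v ⬝ᵥ H *ᵥ v = 0 := by
  obtain ⟨k, hk⟩ := Function.ne_iff.mp hg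
  set w : Fin 3 → K := Pi.single k 1
  have hgw : g ⬝ᵥ w ≠ 0 := by simpa [w] using hk
  have hP := det_ne_zero_of_dotProduct_ne_zero hind hgp hgv hgw
  set r : Fin 3 → Fin 3 → K := ![p, v, w]
  set P : Matrix (Fin 3) (Fin 3) K := Matrix.of r
  have hentry (i j : Fin 3) : (P * H * Pᵀ) i j = r i ⬝ᵥ H *ᵥ r j := by
    rw [Matrix.mul_assoc]
    rfl
  have hsymm (x y : Fin 3 → K) : x ⬝ᵥ H *ᵥ y = y ⬝ᵥ H *ᵥ x := by
    rw [Matrix.dotProduct_mulVec, ← Matrix.mulVec_transpose, hH.eq, dotProduct_comm]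
  have hright (x : Fin 3 → K) : x ⬝ᵥ H *ᵥ p = c * (g ⬝ᵥ x) := by
    rw [hHp, dotProduct_smul, smul_eq_mul, dotProduct_comm]
  have hdet : P.det ^ 2 * H.det = -((c * (g ⬝ᵥ w)) ^ 2 * (v ⬝ᵥ H *ᵥ v)) := by
    calc P.det ^ 2 * H.det = (P * H * Pᵀ).det := by
          rw [Matrix.det_mul, Matrix.det_mul, Matrix.det_transpose]; ring
      _ = _ := by
          rw [Matrix.det_fin_three]
          simp only [hentry]
          simp only [r, Matrix.cons_val]
          rw [hsymm p v, hsymm p w, hright, hright, hright, hgp, hgv]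
          ring
  constructor
  · intro h
    simpa [h, hc, hgw] using hdet
  · intro h
    simpa [h, hP] using hdet

/-- Partial derivatives of multivariate polynomials commute. -/
theorem MvPolynomial.pderiv_pderiv_comm {σ R : Type*} [CommRing R] (i j : σ)
    (F : MvPolynomial σ R) : pderiv i (pderiv j F) = pderiv j (pderiv i F) := by
  classical
  have h : ⁅pderiv (R := R) i, pderiv j⁆ = 0 :=
    MvPolynomial.derivation_ext fun k => by
      rw [Derivation.commutator_apply]
      simp [pderiv_X, Pi.single_apply, apply_ite]
  exact sub_eq_zero.mp ((Derivation.commutator_apply ..).symm.trans (DFunLike.congr_fun h F))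

/-- Euler's identity for a homogeneous polynomial, evaluated at a point. -/
theorem MvPolynomial.IsHomogeneous.sum_mul_eval_pderiv {σ R : Type*} [Fintype σ] [CommSemiring R]
    {n : ℕ} {F : MvPolynomial σ R} (hF : F.IsHomogeneous n) (p : σ → R) :
    ∑ i, p i * eval p (pderiv i F) = n * eval p F := by
  simpa using congrArg (eval p) hF.sum_X_mul_pderiv

/-- Flex criterion via the Hessian: for a smooth point `p` of the plane curve
`V(F)` with tangent direction `v`, the Hessian determinant of `F` vanishes at
`p` if and only if `vᵀ H_p v = 0`, i.e., exactly when `p` is a flex of the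
curve (the tangent line has contact of order greater than `2`). -/
theorem flex_iff_hessian_det_eq_zero {d : ℕ}
    (F : MvPolynomial (Fin 3) ℂ) (hF : F.IsHomogeneous d) (hd : 2 ≤ d)
    (p v : Fin 3 → ℂ)
    (hp : MvPolynomial.eval p F = 0)
    (hsmooth : (fun i : Fin 3 => MvPolynomial.eval p (MvPolynomial.pderiv i F)) ≠ 0)
    (hind : LinearIndependent ℂ ![p, v])
    (htangent : ∑ i : Fin 3, MvPolynomial.eval p (MvPolynomial.pderiv i F) * v i = 0)
    (H : Matrix (Fin 3) (Fin 3) ℂ)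
    (hH : ∀ i j : Fin 3,
      H i j = MvPolynomial.eval p (MvPolynomial.pderiv i (MvPolynomial.pderiv j F))) :
    H.det = 0 ↔ ∑ i : Fin 3, ∑ j : Fin 3, v i * H i j * v j = 0 := by
  have hHp : H *ᵥ p = ((d - 1 : ℕ) : ℂ) • fun i => eval p (pderiv i F) := by
    ext i
    rw [Matrix.mulVec, dotProduct, Pi.smul_apply, smul_eq_mul, ← hF.pderiv.sum_mul_eval_pderiv]
    refine Finset.sum_congr rfl fun j _ => ?_
    rw [hH, pderiv_pderiv_comm, mul_comm]
  have hsymm : H.IsSymm := Matrix.IsSymm.ext fun i j => by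
    rw [hH, hH, pderiv_pderiv_comm]
  have hgp : (fun i => eval p (pderiv i F)) ⬝ᵥ p = 0 := by
    rw [dotProduct_comm]
    simpa [hp, dotProduct] using hF.sum_mul_eval_pderiv p
  have hc : ((d - 1 : ℕ) : ℂ) ≠ 0 := Nat.cast_ne_zero.mpr (by omega)
  rw [det_eq_zero_iff_isotropic_of_mulVec_eq_smul hsymm hc hHp hsmooth hind hgp htangent]
  simp only [dotProduct, Matrix.mulVec, Finset.mul_sum, mul_assoc]
end

section
/- Let F be a homogeneous polynomial of degree d ≥ 3 in the three variables x₀, x₁, x₂ over ℂ defining a smooth plane curve, i.e., there is no nonzero ξ ∈ ℂ³ at which F and all three first partial derivatives of F vanish simultaneously. Then the curve C = V(F) has a flex: there exists a nonzero point p ∈ ℂ³ with F(p) = 0 and det H_p = 0, where H_p is the 3×3 Hessian matrix (H_p)_{ij} = (∂_i∂_j F)(p). -/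
open MvPolynomial

/-- The origin of affine `n`-space has codimension at least `n`. -/
theorem le_height_vanishingIdeal_zero (K : Type*) [Field K] (n : ℕ) :
    (n : ℕ∞) ≤ (vanishingIdeal K ({0} : Set (Fin n → K))).height := by
  let φ (k : ℕ) : MvPolynomial (Fin n) K →ₐ[K] MvPolynomial (Fin n) K :=
    aeval fun i => if (i : ℕ) < k then 0 else X i
  have φ_X (k : ℕ) (i : Fin n) : φ k (X i) = if (i : ℕ) < k then 0 else X i := by simp [φ]
  have ker_prime (k : ℕ) : (RingHom.ker (φ k)).IsPrime := RingHom.ker_isPrime _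
  have ker_lt (k : ℕ) (hk : k < n) : RingHom.ker (φ k) < RingHom.ker (φ (k + 1)) := by
    refine lt_of_le_of_ne (fun p hp => ?_) fun h => ?_
    · have hcomp : (φ (k + 1)).comp (φ k) = φ (k + 1) := by
        ext1 i
        rw [AlgHom.comp_apply, φ_X, φ_X]
        by_cases h₁ : (i : ℕ) < k
        · simp [h₁, Nat.lt_succ_of_lt h₁]
        · simp only [h₁, if_false, φ_X]
      rw [RingHom.mem_ker] at hp ⊢
      rw [← hcomp, AlgHom.comp_apply, hp, map_zero]
    · have hX : (X ⟨k, hk⟩ : MvPolynomial (Fin n) K) ∈ RingHom.ker (φ (k + 1)) := by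
        rw [RingHom.mem_ker, φ_X, if_pos (Nat.lt_succ_self k)]
      rw [← h, RingHom.mem_ker, φ_X, if_neg (lt_irrefl k)] at hX
      exact X_ne_zero _ hX
  have le_height (k : ℕ) (hk : k ≤ n) : (k : ℕ∞) ≤ (RingHom.ker (φ k)).height := by
    induction k with
    | zero => simp
    | succ k ih =>
      push_cast
      exact (add_le_add_left (ih (by lia)) 1).trans
        (Ideal.height_add_one_le_of_lt_of_isPrime (ker_lt k (by lia)))
  refine (le_height n le_rfl).trans (Ideal.height_mono fun p hp => ?_)
  have hcomp : (aeval (0 : Fin n → K)).comp (φ n) = aeval (0 : Fin n → K) := by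
    ext1 i
    rw [AlgHom.comp_apply, φ_X, if_pos i.isLt]
    simp
  rw [mem_vanishingIdeal_singleton_iff, ← hcomp, AlgHom.comp_apply, (RingHom.mem_ker).1 hp,
    map_zero]

/-- Fewer than `n` polynomials in `n` variables that vanish at the origin have another common
zero. -/
theorem exists_ne_zero_eval_eq_zero {K : Type*} [Field K] [IsAlgClosed K] {n : ℕ}
    {S : Set (MvPolynomial (Fin n) K)} (hfin : S.Finite) (hcard : S.ncard < n)
    (hS : ∀ f ∈ S, eval 0 f = 0) :
    ∃ p : Fin n → K, p ≠ 0 ∧ ∀ f ∈ S, eval p f = 0 := by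
  by_contra! h
  have hlocus : zeroLocus K (Ideal.span S) = {0} := by
    ext p
    rw [zeroLocus_span]
    simp only [Set.mem_ofPred_eq, Set.mem_singleton_iff, aeval_eq_eval]
    refine ⟨fun hp => ?_, fun hp => hp ▸ hS⟩
    by_contra hp₀
    obtain ⟨f, hf, hne⟩ := h p hp₀
    exact hne (hp f hf)
  have hrad : (Ideal.span S).radical = vanishingIdeal K ({0} : Set (Fin n → K)) := by
    rw [← hlocus, vanishingIdeal_zeroLocus_eq_radical]
  have hmin : vanishingIdeal K ({0} : Set (Fin n → K)) ∈ (Ideal.span S).minimalPrimes := by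
    rw [← Ideal.radical_minimalPrimes, hrad, Ideal.minimalPrimes_eq_subsingleton_self]
    rfl
  have hle := (le_height_vanishingIdeal_zero K n).trans
    (Ideal.height_le_card_of_mem_minimalPrimes_span hfin hmin)
  exact absurd (Nat.cast_le.1 hle) (not_le.2 hcard)

theorem MvPolynomial.IsHomogeneous.eval_zero_eq_zero {σ R : Type*} [CommSemiring R] {m : ℕ}
    {f : MvPolynomial σ R} (hf : f.IsHomogeneous m) (hm : m ≠ 0) : eval 0 f = 0 := by
  rw [eval_zero]
  exact hf.coeff_eq_zero (by simpa using hm.symm)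

/-- A smooth plane curve of degree `d ≥ 3` has a flex: there is a nonzero point
`p` on the curve at which the Hessian determinant of `F` vanishes. -/
theorem smooth_plane_curve_has_flex {d : ℕ}
    (F : MvPolynomial (Fin 3) ℂ) (hF : F.IsHomogeneous d) (hd : 3 ≤ d)
    (hsmooth : ¬ ∃ ξ : Fin 3 → ℂ, ξ ≠ 0 ∧ MvPolynomial.eval ξ F = 0 ∧
      ∀ i : Fin 3, MvPolynomial.eval ξ (MvPolynomial.pderiv i F) = 0) :
    ∃ p : Fin 3 → ℂ, p ≠ 0 ∧ MvPolynomial.eval p F = 0 ∧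
      Matrix.det (Matrix.of fun i j : Fin 3 =>
        MvPolynomial.eval p (MvPolynomial.pderiv i (MvPolynomial.pderiv j F))) = 0 := by
  let H : MvPolynomial (Fin 3) ℂ := (Matrix.of fun i j => pderiv i (pderiv j F)).det
  have eval_H (p : Fin 3 → ℂ) :
      eval p H = (Matrix.of fun i j => eval p (pderiv i (pderiv j F))).det := by
    rw [RingHom.map_det]
    rfl
  have hF₀ : eval 0 F = 0 := hF.eval_zero_eq_zero (by lia)
  have hH₀ : eval 0 H = 0 := by
    rw [eval_H]
    refine Matrix.det_eq_zero_of_row_eq_zero 0 fun j => ?_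
    exact (hF.pderiv.pderiv).eval_zero_eq_zero (by lia)
  obtain ⟨p, hp₀, hp⟩ := exists_ne_zero_eval_eq_zero (S := {F, H}) (Set.toFinite _)
    ((Set.ncard_insert_le _ _).trans_lt (by simp)) (by rintro f (rfl | rfl) <;> assumption)
  exact ⟨p, hp₀, hp F (by simp), eval_H p ▸ hp H (by simp)⟩
end
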